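/- Let p ∈ [1, p_c), γ ∈ ℝ, and suppose ‖f(·,t)‖_{L^1(ℝ^N)} ≤ C₀ (1+t)^{−γ} for all t ≥ 0. Then for every compact set K ⊂ ℝ^N there is a constant C such that the mild solution u satisfies, for all t ≥ 2: ‖u(·,t)‖_{L^p(K)} ≤ C t^{−γ} if γ ≤ 1+α, and ‖u(·,t)‖_{L^p(K)} ≤ C t^{−(1+α)} if γ ≥ 1+α. -/

import Mathlib

open MeasureTheory Real Set Filter
open scoped ENNReal Pointwise

lemma aux_minkowski {X Z : Type*} [MeasurableSpace X] [MeasurableSpace Z]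
    (μ : Measure X) (ν : Measure Z) [SFinite μ] [SFinite ν]
    (k : X → Z → ℝ≥0∞) (hk : Measurable (Function.uncurry k))
    (M w : Z → ℝ≥0∞) (hM : Measurable M) (hw : Measurable w) (p : ℝ) (hp : 1 ≤ p)
    (h : ∀ᵐ z ∂ν, M z ≠ 0 ∧ M z ≠ ∞ ∧ ∫⁻ x, k x z ^ p ∂μ ≤ M z ^ p) :
    ∫⁻ x, (∫⁻ z, k x z * w z ∂ν) ^ p ∂μ ≤ (∫⁻ z, M z * w z ∂ν) ^ p := by
  have hp0 : 0 < p := by linarith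
  have hip : 1 / p ≤ 1 := by rw [div_le_one hp0]; exact hp
  have hkx : ∀ x, Measurable (k x) := fun x => hk.comp measurable_prodMk_left
  have key : ∀ x, (∫⁻ z, k x z * w z ∂ν) ^ p ≤
      (∫⁻ z, k x z ^ p * (M z ^ (1 - p) * w z) ∂ν) * (∫⁻ z, M z * w z ∂ν) ^ (p - 1) := by
    intro x
    have hx := hkx x
    have e1 : ∫⁻ z, k x z * w z ∂ν =
        ∫⁻ z, (k x z ^ p * (M z ^ (1 - p) * w z)) ^ (1 / p) * (M z * w z) ^ (1 - 1 / p) ∂ν := by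
      apply lintegral_congr_ae
      filter_upwards [h] with z hz
      obtain ⟨h0, ht, -⟩ := hz
      have hn : 0 ≤ 1 / p := by positivity
      have hn' : 0 ≤ 1 - 1 / p := by linarith
      rw [ENNReal.mul_rpow_of_nonneg _ _ hn, ENNReal.mul_rpow_of_nonneg _ _ hn,
        ENNReal.mul_rpow_of_nonneg _ _ hn', ← ENNReal.rpow_mul, ← ENNReal.rpow_mul]
      have a1 : p * (1 / p) = 1 := by field_simp
      have a2 : M z ^ ((1 - p) * (1 / p)) * M z ^ (1 - 1 / p) = 1 := by
        rw [← ENNReal.rpow_add _ _ h0 ht]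
        have : (1 - p) * (1 / p) + (1 - 1 / p) = 0 := by field_simp; ring
        rw [this, ENNReal.rpow_zero]
      have a3 : w z ^ (1 / p) * w z ^ (1 - 1 / p) = w z := by
        rw [← ENNReal.rpow_add_of_nonneg _ _ hn hn']; simp
      rw [a1, ENNReal.rpow_one]
      calc k x z * w z = k x z * (1 * w z) := by rw [one_mul]
        _ = k x z * ((M z ^ ((1 - p) * (1 / p)) * M z ^ (1 - 1 / p)) *
            (w z ^ (1 / p) * w z ^ (1 - 1 / p))) := by rw [a2, a3]
        _ = _ := by ring
    rw [e1]
    have := ENNReal.lintegral_mul_norm_pow_le (μ := ν)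
      (f := fun z => k x z ^ p * (M z ^ (1 - p) * w z)) (g := fun z => M z * w z)
      (by fun_prop) (by fun_prop) (p := 1 / p) (q := 1 - 1 / p)
      (by positivity) (by linarith) (by ring)
    refine (ENNReal.rpow_le_rpow this hp0.le).trans (le_of_eq ?_)
    rw [ENNReal.mul_rpow_of_nonneg _ _ hp0.le, ← ENNReal.rpow_mul, ← ENNReal.rpow_mul]
    have a1 : (1 / p) * p = 1 := by field_simp
    have a2 : (1 - 1 / p) * p = p - 1 := by field_simp
    rw [a1, a2, ENNReal.rpow_one]
  have hF : Measurable (Function.uncurry fun x z => k x z ^ p * (M z ^ (1 - p) * w z)) := by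
    have h1 : Measurable fun q : X × Z => k q.1 q.2 := hk
    show Measurable fun q : X × Z => k q.1 q.2 ^ p * (M q.2 ^ (1 - p) * w q.2)
    fun_prop
  calc ∫⁻ x, (∫⁻ z, k x z * w z ∂ν) ^ p ∂μ
      ≤ ∫⁻ x, (∫⁻ z, k x z ^ p * (M z ^ (1 - p) * w z) ∂ν) * (∫⁻ z, M z * w z ∂ν) ^ (p - 1) ∂μ :=
        lintegral_mono key
    _ = (∫⁻ x, (∫⁻ z, k x z ^ p * (M z ^ (1 - p) * w z) ∂ν) ∂μ) *
          (∫⁻ z, M z * w z ∂ν) ^ (p - 1) := by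
        rw [lintegral_mul_const]
        exact hF.lintegral_prod_right'
    _ = (∫⁻ z, (∫⁻ x, k x z ^ p * (M z ^ (1 - p) * w z) ∂μ) ∂ν) *
          (∫⁻ z, M z * w z ∂ν) ^ (p - 1) := by
        rw [lintegral_lintegral_swap hF.aemeasurable]
    _ ≤ (∫⁻ z, M z * w z ∂ν) * (∫⁻ z, M z * w z ∂ν) ^ (p - 1) := by
        gcongr ?_ * _
        apply lintegral_mono_ae
        filter_upwards [h] with z hz
        obtain ⟨h0, ht, hb⟩ := hz
        have hkz : Measurable fun x => k x z := hk.comp measurable_prodMk_right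
        rw [lintegral_mul_const _ (by fun_prop), ← mul_assoc]
        gcongr ?_ * _
        calc _ ≤ M z ^ p * M z ^ (1 - p) := by gcongr
          _ = M z := by rw [← ENNReal.rpow_add _ _ h0 ht]; simp
    _ = _ := by
        nth_rw 1 [← ENNReal.rpow_one (∫⁻ z, M z * w z ∂ν)]
        rw [← ENNReal.rpow_add_of_nonneg _ _ zero_le_one (by linarith)]
        congr 1; ring

lemma aux_sing (N : ℕ) (b : ℝ) (hb0 : 0 ≤ b) (hb : b < N)
    (K : Set (EuclideanSpace ℝ (Fin N))) (hK : IsCompact K) :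
    ∃ A : ℝ≥0∞, A ≠ ∞ ∧ ∀ y : EuclideanSpace ℝ (Fin N),
      ∫⁻ x in K, ENNReal.ofReal (‖x - y‖ ^ (-b)) ≤ A := by
  have hNpos : 0 < N := by
    have : (0:ℝ) < N := lt_of_le_of_lt hb0 hb
    exact_mod_cast this
  have : NeZero N := ⟨hNpos.ne'⟩
  have hint : IntegrableOn (fun x : EuclideanSpace ℝ (Fin N) => ‖x‖ ^ (-b)) (Metric.ball 0 1) := by
    have := integrableOn_fun_norm_addHaar (E := EuclideanSpace ℝ (Fin N)) (μ := volume)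
      (f := fun r : ℝ => r ^ (-b)) (r := 1)
    rw [this]
    have h2 : IntegrableOn (fun x : ℝ => x ^ ((N : ℝ) - 1 - b)) (Ioo 0 1) := by
      rw [intervalIntegral.integrableOn_Ioo_rpow_iff one_pos]; linarith
    refine h2.congr_fun ?_ measurableSet_Ioo
    intro x hx
    simp only [finrank_euclideanSpace, Fintype.card_fin, smul_eq_mul]
    rw [← Real.rpow_natCast, ← Real.rpow_add hx.1, Nat.cast_sub hNpos]
    congr 1; push_cast; ring
  refine ⟨(∫⁻ x in Metric.ball (0 : EuclideanSpace ℝ (Fin N)) 1, ENNReal.ofReal (‖x‖ ^ (-b))) +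
      volume K,
    ?_, ?_⟩
  · refine ENNReal.add_ne_top.2 ⟨?_, hK.measure_lt_top.ne⟩
    exact (Integrable.lintegral_lt_top hint).ne
  · intro y
    set g : EuclideanSpace ℝ (Fin N) → ℝ≥0∞ :=
      (Metric.ball 0 1).indicator fun x => ENNReal.ofReal (‖x‖ ^ (-b)) with hg
    have hgm : Measurable g := by
      apply Measurable.indicator _ measurableSet_ball
      fun_prop
    calc ∫⁻ x in K, ENNReal.ofReal (‖x - y‖ ^ (-b))
        ≤ ∫⁻ x in K, (g (x - y) + 1) := by
          apply lintegral_mono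
          intro x
          by_cases hx : x - y ∈ Metric.ball (0 : EuclideanSpace ℝ (Fin N)) 1
          · simp only [hg, indicator_of_mem hx]; exact le_self_add
          · simp only [hg, indicator_of_notMem hx, zero_add]
            rw [ENNReal.ofReal_le_one]
            apply Real.rpow_le_one_of_one_le_of_nonpos _ (by linarith)
            simpa using hx
      _ = (∫⁻ x in K, g (x - y)) + volume K := by
          rw [lintegral_add_right _ measurable_const]; simp
      _ ≤ (∫⁻ x, g (x - y)) + volume K := by
          gcongr; exact Measure.restrict_le_self
      _ = _ := by
          rw [lintegral_sub_right_eq_self g y, hg, lintegral_indicator measurableSet_ball]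

lemma aux_kernel (N : ℕ) (α β : ℝ)
    (G : EuclideanSpace ℝ (Fin N) → ℝ)
    (c₂ : ℝ) (hc₂ : 0 < c₂)
    (hGin : ∀ ξ : EuclideanSpace ℝ (Fin N), 0 < ‖ξ‖ → ‖ξ‖ ≤ 1 →
      G ξ ≤ c₂ * ‖ξ‖ ^ (4 * β - (N : ℝ)))
    (hGout : ∀ ξ : EuclideanSpace ℝ (Fin N), 1 ≤ ‖ξ‖ →
      G ξ ≤ c₂ * ‖ξ‖ ^ (-((N : ℝ) + 2 * β)))
    (a : ℝ) (ha1 : (N : ℝ) - 4 * β ≤ a) (ha2 : a ≤ N + 2 * β)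
    (x : EuclideanSpace ℝ (Fin N)) (hx : x ≠ 0) (τ : ℝ) (hτ : 0 < τ) :
    τ ^ (α - 1 - α * (N : ℝ) / (2 * β)) * G ((τ ^ (-(α / (2 * β)))) • x) ≤
      c₂ * τ ^ (α - 1 - α / (2 * β) * (N - a)) * ‖x‖ ^ (-a) := by
  have hG : ∀ ξ : EuclideanSpace ℝ (Fin N), ξ ≠ 0 → G ξ ≤ c₂ * ‖ξ‖ ^ (-a) := by
    intro ξ hξ
    have h0 : 0 < ‖ξ‖ := norm_pos_iff.2 hξ
    rcases le_total ‖ξ‖ 1 with h | h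
    · refine (hGin ξ h0 h).trans ?_
      gcongr c₂ * ?_
      exact Real.rpow_le_rpow_of_exponent_ge h0 h (by linarith)
    · refine (hGout ξ h).trans ?_
      gcongr c₂ * ?_
      exact Real.rpow_le_rpow_of_exponent_le h (by linarith)
  have hpos : 0 < τ ^ (-(α / (2 * β))) := Real.rpow_pos_of_pos hτ _
  have h1 := hG _ (smul_ne_zero hpos.ne' hx)
  rw [norm_smul, Real.norm_of_nonneg hpos.le, Real.mul_rpow hpos.le (norm_nonneg _),
    ← Real.rpow_mul hτ.le] at h1
  calc _ ≤ τ ^ (α - 1 - α * (N : ℝ) / (2 * β)) * (c₂ * (τ ^ (-(α / (2 * β)) * -a) * ‖x‖ ^ (-a))) := by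
        gcongr
    _ = c₂ * (τ ^ (α - 1 - α * (N : ℝ) / (2 * β)) * τ ^ (-(α / (2 * β)) * -a)) * ‖x‖ ^ (-a) := by ring
    _ = _ := by
        rw [← Real.rpow_add hτ]
        congr 3
        ring

noncomputable def auxm (e α : ℝ) : ℝ → ℝ≥0∞ :=
  (Ioi (0:ℝ)).indicator fun τ => ENNReal.ofReal (if τ < 1 then τ ^ e else τ ^ (-(1 + α)))

lemma auxm_meas (e α : ℝ) : Measurable (auxm e α) := by
  apply Measurable.indicator _ measurableSet_Ioi
  apply ENNReal.measurable_ofReal.comp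
  apply Measurable.ite measurableSet_Iio <;> fun_prop

lemma auxm_int (e α : ℝ) (he : -1 < e) (hα : 0 < α) : ∫⁻ τ, auxm e α τ ≠ ∞ := by
  have h1 : IntegrableOn (fun x : ℝ => x ^ e) (Ioo 0 1) := by
    rw [intervalIntegral.integrableOn_Ioo_rpow_iff one_pos]; exact he
  have h2 : IntegrableOn (fun x : ℝ => x ^ (-(1 + α))) (Ioi (1/2)) :=
    integrableOn_Ioi_rpow_of_lt (by linarith) (by norm_num)
  have hle : ∀ τ, auxm e α τ ≤ (Ioo (0:ℝ) 1).indicator (fun τ => ENNReal.ofReal (τ ^ e)) τ +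
      (Ioi (1/2:ℝ)).indicator (fun τ => ENNReal.ofReal (τ ^ (-(1 + α)))) τ := by
    intro τ
    unfold auxm
    by_cases h0 : 0 < τ
    · rw [indicator_of_mem (show τ ∈ Ioi (0:ℝ) from h0)]
      by_cases h1 : τ < 1
      · rw [if_pos h1, indicator_of_mem (show τ ∈ Ioo (0:ℝ) 1 from ⟨h0, h1⟩)]
        exact le_self_add
      · rw [if_neg h1, indicator_of_mem (show τ ∈ Ioi (1/2:ℝ) by simp only [mem_Ioi]; linarith)]
        exact le_add_self
    · rw [indicator_of_notMem (show τ ∉ Ioi (0:ℝ) from h0)]; exact zero_le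
  refine ne_top_of_le_ne_top ?_ (lintegral_mono hle)
  rw [lintegral_add_left, lintegral_indicator measurableSet_Ioo, lintegral_indicator measurableSet_Ioi]
  · exact ENNReal.add_ne_top.2 ⟨(Integrable.lintegral_lt_top h1).ne,
      (Integrable.lintegral_lt_top h2).ne⟩
  · apply Measurable.indicator _ measurableSet_Ioo
    fun_prop

lemma aux_two (σ a t : ℝ) (ha : 0 < a) (ht : 0 < t) (h1 : t ≤ 2 * a) (h2 : a ≤ 2 * t) :
    a ^ (-σ) ≤ 2 ^ |σ| * t ^ (-σ) := by
  rcases le_total 0 σ with h | h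
  · rw [abs_of_nonneg h]
    have : (2 * a) ^ (-σ) ≤ t ^ (-σ) := Real.rpow_le_rpow_of_nonpos ht h1 (by linarith)
    rw [Real.mul_rpow (by norm_num) ha.le] at this
    calc a ^ (-σ) = 2 ^ σ * (2 ^ (-σ) * a ^ (-σ)) := by
          rw [← mul_assoc, ← Real.rpow_add two_pos]; simp
      _ ≤ _ := by gcongr
  · rw [abs_of_nonpos h, ← Real.mul_rpow (by norm_num) ht.le]
    exact Real.rpow_le_rpow ha.le h2 (by linarith)

lemma aux_time (e α σ : ℝ) (hα : 0 < α) (hσ : σ ≤ 1 + α) (t s : ℝ) (ht : 2 ≤ t)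
    (hs0 : 0 < s) (hst : s < t) :
    auxm e α (t - s) * ENNReal.ofReal ((1 + s) ^ (-σ)) ≤
      ENNReal.ofReal (2 ^ |σ| * t ^ (-σ)) * (auxm e α (t - s) + auxm e α (1 + s)) := by
  by_cases hc : t ≤ 2 * (1 + s)
  · rw [mul_add, mul_comm]
    refine le_trans ?_ le_self_add
    gcongr
    exact aux_two σ (1 + s) t (by linarith) (by linarith) hc (by linarith)
  · push Not at hc
    rw [mul_add]
    refine le_trans ?_ le_add_self
    have h1 : ¬ (t - s < 1) := by linarith
    have h2 : ¬ (1 + s < 1) := by linarith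
    unfold auxm
    rw [indicator_of_mem (show t - s ∈ Ioi (0:ℝ) by simp only [mem_Ioi]; linarith),
      indicator_of_mem (show 1 + s ∈ Ioi (0:ℝ) by simp only [mem_Ioi]; linarith), if_neg h1, if_neg h2,
      ← ENNReal.ofReal_mul (by apply Real.rpow_nonneg; linarith),
      ← ENNReal.ofReal_mul (by have : 0 < t := by linarith
                               positivity)]
    apply ENNReal.ofReal_le_ofReal
    have hA : 0 < t - s := by linarith
    have hB : 0 < 1 + s := by linarith
    have e1 : (t - s) ^ (-(1 + α)) = (t - s) ^ (-σ) * (t - s) ^ (-(1 + α - σ)) := by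
      rw [← Real.rpow_add hA]; congr 1; ring
    have e2 : (1 + s) ^ (-(1 + α)) = (1 + s) ^ (-(1 + α - σ)) * (1 + s) ^ (-σ) := by
      rw [← Real.rpow_add hB]; congr 1; ring
    rw [e1, e2, ← mul_assoc]
    refine mul_le_mul_of_nonneg_right (mul_le_mul ?_ ?_ ?_ ?_) ?_
    · exact aux_two σ (t - s) t hA (by linarith) (by linarith) (by linarith)
    · exact Real.rpow_le_rpow_of_nonpos hB (by linarith) (by linarith)
    · positivity
    · have : 0 < t := by linarith
      positivity
    · positivity

theorem compact_sets_decay_subcritical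
    (N : ℕ) (α β : ℝ)
    (hα : 0 < α ∧ α < 1) (hβ : 0 < β ∧ β ≤ 1) (hN : 4 * β < (N : ℝ))
    (G : EuclideanSpace ℝ (Fin N) → ℝ)
    (hGmeas : Measurable G) (hGnonneg : ∀ ξ, 0 ≤ G ξ)
    (c₁ c₂ : ℝ) (hc₁ : 0 < c₁) (hc₂ : 0 < c₂)
    (hGin : ∀ ξ : EuclideanSpace ℝ (Fin N), 0 < ‖ξ‖ → ‖ξ‖ ≤ 1 →
      c₁ * ‖ξ‖ ^ (4 * β - (N : ℝ)) ≤ G ξ ∧ G ξ ≤ c₂ * ‖ξ‖ ^ (4 * β - (N : ℝ)))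
    (hGout : ∀ ξ : EuclideanSpace ℝ (Fin N), 1 ≤ ‖ξ‖ →
      c₁ * ‖ξ‖ ^ (-((N : ℝ) + 2 * β)) ≤ G ξ ∧ G ξ ≤ c₂ * ‖ξ‖ ^ (-((N : ℝ) + 2 * β)))
    (Y : EuclideanSpace ℝ (Fin N) → ℝ → ℝ)
    (hY : ∀ x t, Y x t = t ^ (α - 1 - α * (N : ℝ) / (2 * β)) * G ((t ^ (-(α / (2 * β)))) • x))
    (f : EuclideanSpace ℝ (Fin N) → ℝ → ℝ)
    (hfmeas : Measurable (Function.uncurry f))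
    (γ : ℝ) (C₀ : ℝ) (hC₀ : 0 < C₀)
    (hf1 : ∀ t : ℝ, 0 ≤ t →
      eLpNorm (fun y => f y t) 1 volume ≤ ENNReal.ofReal (C₀ * (1 + t) ^ (-γ)))
    (u : EuclideanSpace ℝ (Fin N) → ℝ → ℝ)
    (hu : ∀ x t, u x t = ∫ s in Set.Ioc (0:ℝ) t, ∫ y, Y (x - y) (t - s) * f y s)
    (p : ℝ) (hp1 : 1 ≤ p) (hpc : p < (N : ℝ) / ((N : ℝ) - 2 * β))
    (K : Set (EuclideanSpace ℝ (Fin N))) (hK : IsCompact K) :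
    ∃ C : ℝ, 0 < C ∧ ∀ t : ℝ, 2 ≤ t →
      (γ ≤ 1 + α →
        eLpNorm (fun x => u x t) (ENNReal.ofReal p) (volume.restrict K) ≤
          ENNReal.ofReal (C * t ^ (-γ))) ∧
      (1 + α ≤ γ →
        eLpNorm (fun x => u x t) (ENNReal.ofReal p) (volume.restrict K) ≤
          ENNReal.ofReal (C * t ^ (-(1 + α)))) := by
  obtain ⟨hα0, hα1⟩ := hα
  obtain ⟨hβ0, hβ1⟩ := hβ
  have hp0 : 0 < p := by linarith
  have hN2 : 0 < (N : ℝ) - 2 * β := by linarith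
  have hNp : (N : ℝ) - 2 * β < N / p := by
    rw [lt_div_iff₀ hp0]
    rw [lt_div_iff₀ hN2] at hpc
    linarith
  obtain ⟨a, ha1, ha2⟩ := exists_between hNp
  have hap : a * p < N := by rwa [lt_div_iff₀ hp0] at ha2
  have haN : a ≤ N := by nlinarith
  have ha0p : ((N : ℝ) - 4 * β) * p < N := by nlinarith
  obtain ⟨A₁, hA₁, hA₁b⟩ := aux_sing N (a * p) (by nlinarith) hap K hK
  obtain ⟨A₂, hA₂, hA₂b⟩ := aux_sing N (((N : ℝ) - 4 * β) * p) (by nlinarith) ha0p K hK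
  set e : ℝ := α - 1 - α / (2 * β) * (N - a) with he
  have he1 : -1 < e := by
    have h1 : α / (2 * β) * (N - a) < α / (2 * β) * (2 * β) :=
      mul_lt_mul_of_pos_left (by linarith) (by positivity)
    have h2 : α / (2 * β) * (2 * β) = α := by field_simp
    linarith
  set S : ℝ≥0∞ := A₁ + A₂ + 1 with hS
  have hStop : S ≠ ∞ := by simp [hS, hA₁, hA₂]
  have hS1 : 1 ≤ S := le_add_self
  have hSp : S ≤ S ^ p := by
    calc S = S ^ (1:ℝ) := by simp
      _ ≤ S ^ p := ENNReal.rpow_le_rpow_of_exponent_le hS1 hp1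
  set A : ℝ≥0∞ := ENNReal.ofReal c₂ * S with hA
  have hAtop : A ≠ ∞ := ENNReal.mul_ne_top ENNReal.ofReal_ne_top hStop
  have hA0 : A ≠ 0 := mul_ne_zero (by simpa using hc₂) (by
    intro h; rw [h] at hS1; simp at hS1)
  have hNpos : 0 < N := by
    have : (0:ℝ) < N := by linarith
    exact_mod_cast this
  have : NeZero N := ⟨hNpos.ne'⟩
  have hgen : ∀ b : ℝ, (N : ℝ) - 4 * β ≤ b → b ≤ N + 2 * β →
      (∀ y : EuclideanSpace ℝ (Fin N), ∫⁻ x in K, ENNReal.ofReal (‖x - y‖ ^ (-(b * p))) ≤ S ^ p) →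
      ∀ τ : ℝ, 0 < τ → ∀ y, ∫⁻ x in K, ENNReal.ofReal (Y (x - y) τ) ^ p ≤
        (A * ENNReal.ofReal (τ ^ (α - 1 - α / (2 * β) * (N - b)))) ^ p := by
    intro b hb1 hb2 hb3 τ hτ y
    have hne : ∀ᵐ x ∂(volume.restrict K), x ≠ y :=
      ae_restrict_of_ae (Measure.ae_ne volume y)
    have hτ' : 0 ≤ τ ^ (α - 1 - α / (2 * β) * (N - b)) := by positivity
    calc ∫⁻ x in K, ENNReal.ofReal (Y (x - y) τ) ^ p
        ≤ ∫⁻ x in K, ENNReal.ofReal (c₂ * τ ^ (α - 1 - α / (2 * β) * (N - b))) ^ p *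
            ENNReal.ofReal (‖x - y‖ ^ (-(b * p))) := by
          apply lintegral_mono_ae
          filter_upwards [hne] with x hx
          have h1 := aux_kernel N α β G c₂ hc₂ (fun ξ h h' => (hGin ξ h h').2)
            (fun ξ h => (hGout ξ h).2) b hb1 hb2 (x - y) (sub_ne_zero.2 hx) τ hτ
          rw [← hY] at h1
          have h2 := ENNReal.rpow_le_rpow (ENNReal.ofReal_le_ofReal h1) hp0.le
          refine h2.trans (le_of_eq ?_)
          rw [ENNReal.ofReal_mul (by positivity), ENNReal.mul_rpow_of_nonneg _ _ hp0.le]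
          congr 1
          rw [ENNReal.ofReal_rpow_of_nonneg (by positivity) hp0.le, ← Real.rpow_mul (norm_nonneg _)]
          congr 2
          ring
      _ = ENNReal.ofReal (c₂ * τ ^ (α - 1 - α / (2 * β) * (N - b))) ^ p *
            ∫⁻ x in K, ENNReal.ofReal (‖x - y‖ ^ (-(b * p))) := by
          rw [lintegral_const_mul _ (by fun_prop)]
      _ ≤ ENNReal.ofReal (c₂ * τ ^ (α - 1 - α / (2 * β) * (N - b))) ^ p * S ^ p := by
          gcongr; exact hb3 y
      _ = _ := by
          rw [← ENNReal.mul_rpow_of_nonneg _ _ hp0.le, ENNReal.ofReal_mul hc₂.le, hA]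
          congr 1; ring
  have hker : ∀ τ : ℝ, 0 < τ → ∀ y, ∫⁻ x in K, ENNReal.ofReal (Y (x - y) τ) ^ p ≤
        (A * auxm e α τ) ^ p := by
    intro τ hτ y
    unfold auxm
    rw [indicator_of_mem (show τ ∈ Ioi (0:ℝ) from hτ)]
    by_cases h1 : τ < 1
    · rw [if_pos h1]
      refine hgen a (by linarith) (by linarith) (fun y => ?_) τ hτ y
      exact ((hA₁b y).trans (le_add_right le_self_add)).trans hSp
    · rw [if_neg h1]
      have h2 := hgen ((N : ℝ) - 4 * β) le_rfl (by linarith)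
        (fun y => ((hA₂b y).trans (le_add_right le_add_self)).trans hSp) τ hτ y
      have h3 : α - 1 - α / (2 * β) * (N - ((N : ℝ) - 4 * β)) = -(1 + α) := by
        field_simp; ring
      rwa [h3] at h2
  have hYm : Measurable fun q : EuclideanSpace ℝ (Fin N) × ℝ => Y q.1 q.2 := by
    simp only [hY]
    fun_prop
  set σ : ℝ := min γ (1 + α) with hσ
  set I : ℝ≥0∞ := ∫⁻ τ, auxm e α τ with hI
  have hItop : I ≠ ∞ := auxm_int e α he1 hα0
  have hmm := auxm_meas e α
  have hmain : ∀ t : ℝ, 2 ≤ t →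
      eLpNorm (fun x => u x t) (ENNReal.ofReal p) (volume.restrict K) ≤
        A * (ENNReal.ofReal C₀ * (ENNReal.ofReal (2 ^ |σ| * t ^ (-σ)) * (I + I))) := by
    intro t ht
    set ν : Measure (ℝ × EuclideanSpace ℝ (Fin N)) :=
      (volume.restrict (Ioo (0:ℝ) t)).prod volume with hν
    have hwm : Measurable fun z : ℝ × EuclideanSpace ℝ (Fin N) => ‖f z.2 z.1‖ₑ :=
      (hfmeas.comp measurable_swap).enorm
    have hkm : Measurable (Function.uncurry fun (x : EuclideanSpace ℝ (Fin N))
        (z : ℝ × EuclideanSpace ℝ (Fin N)) => ENNReal.ofReal (Y (x - z.2) (t - z.1))) := by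
      apply ENNReal.measurable_ofReal.comp
      exact hYm.comp (f := fun q : EuclideanSpace ℝ (Fin N) × ℝ × EuclideanSpace ℝ (Fin N) =>
        (q.1 - q.2.2, t - q.2.1)) (by fun_prop)
    have hYn : ∀ x τ, 0 ≤ τ → 0 ≤ Y x τ := by
      intro x τ hτ
      rw [hY]
      exact mul_nonneg (Real.rpow_nonneg hτ _) (hGnonneg _)
    have hub : ∀ x, ‖u x t‖ₑ ≤ ∫⁻ z, ENNReal.ofReal (Y (x - z.2) (t - z.1)) * ‖f z.2 z.1‖ₑ ∂ν := by
      intro x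
      have hm : Measurable fun z : ℝ × EuclideanSpace ℝ (Fin N) =>
          ENNReal.ofReal (Y (x - z.2) (t - z.1)) * ‖f z.2 z.1‖ₑ :=
        (hkm.comp measurable_prodMk_left).mul hwm
      rw [hu, hν, lintegral_prod _ hm.aemeasurable, integral_Ioc_eq_integral_Ioo]
      refine (enorm_integral_le_lintegral_enorm _).trans ?_
      apply setLIntegral_mono' measurableSet_Ioo
      intro s hs
      refine (enorm_integral_le_lintegral_enorm _).trans (le_of_eq ?_)
      apply lintegral_congr
      intro y
      rw [enorm_mul, Real.enorm_of_nonneg (hYn _ _ (by linarith [hs.2]))]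
    have hmink := aux_minkowski (volume.restrict K) ν
      (fun x z => ENNReal.ofReal (Y (x - z.2) (t - z.1))) hkm
      (fun z => A * auxm e α (t - z.1)) (fun z => ‖f z.2 z.1‖ₑ) (by fun_prop) hwm p hp1 (by
        have : ∀ᵐ z ∂ν, z.1 ∈ Ioo (0:ℝ) t :=
          Measure.quasiMeasurePreserving_fst.ae (ae_restrict_mem measurableSet_Ioo)
        filter_upwards [this] with z hz
        have hz' : 0 < t - z.1 := by linarith [hz.2]
        refine ⟨mul_ne_zero hA0 ?_, ENNReal.mul_ne_top hAtop ?_, hker _ hz' _⟩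
        · unfold auxm
          rw [indicator_of_mem (show t - z.1 ∈ Ioi (0:ℝ) from hz')]
          have : 0 < (if t - z.1 < 1 then (t - z.1) ^ e else (t - z.1) ^ (-(1 + α))) := by
            split_ifs <;> positivity
          exact (ENNReal.ofReal_pos.2 this).ne'
        · unfold auxm
          rw [indicator_of_mem (show t - z.1 ∈ Ioi (0:ℝ) from hz')]
          exact ENNReal.ofReal_ne_top)
    have hfin : ∫⁻ z, (A * auxm e α (t - z.1)) * ‖f z.2 z.1‖ₑ ∂ν ≤
        A * (ENNReal.ofReal C₀ * (ENNReal.ofReal (2 ^ |σ| * t ^ (-σ)) * (I + I))) := by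
      have hm : Measurable fun z : ℝ × EuclideanSpace ℝ (Fin N) =>
          (A * auxm e α (t - z.1)) * ‖f z.2 z.1‖ₑ := by fun_prop
      rw [hν, lintegral_prod _ hm.aemeasurable]
      calc ∫⁻ s in Ioo 0 t, ∫⁻ y, (A * auxm e α (t - s)) * ‖f y s‖ₑ
          ≤ ∫⁻ s in Ioo 0 t, A * (ENNReal.ofReal C₀ * (ENNReal.ofReal (2 ^ |σ| * t ^ (-σ)) *
              (auxm e α (t - s) + auxm e α (1 + s)))) := by
            apply setLIntegral_mono' measurableSet_Ioo
            intro s hs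
            have hfs : Measurable fun y => ‖f y s‖ₑ := hwm.comp measurable_prodMk_left
            rw [lintegral_const_mul _ hfs, mul_assoc]
            gcongr A * ?_
            have h1 := hf1 s hs.1.le
            rw [eLpNorm_one_eq_lintegral_enorm] at h1
            have h2 : C₀ * (1 + s) ^ (-γ) ≤ C₀ * (1 + s) ^ (-σ) := by
              gcongr C₀ * ?_
              exact Real.rpow_le_rpow_of_exponent_le (by linarith [hs.1])
                (neg_le_neg (min_le_left _ _))
            have h3 := h1.trans (ENNReal.ofReal_le_ofReal h2)
            rw [ENNReal.ofReal_mul hC₀.le] at h3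
            calc auxm e α (t - s) * ∫⁻ y, ‖f y s‖ₑ
                ≤ auxm e α (t - s) * (ENNReal.ofReal C₀ * ENNReal.ofReal ((1 + s) ^ (-σ))) := by
                  gcongr
              _ = ENNReal.ofReal C₀ * (auxm e α (t - s) * ENNReal.ofReal ((1 + s) ^ (-σ))) := by
                  ring
              _ ≤ _ := by
                  gcongr ENNReal.ofReal C₀ * ?_
                  exact aux_time e α σ hα0 (min_le_right _ _) t s ht hs.1 hs.2
        _ ≤ ∫⁻ s, A * (ENNReal.ofReal C₀ * (ENNReal.ofReal (2 ^ |σ| * t ^ (-σ)) *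
              (auxm e α (t - s) + auxm e α (1 + s)))) :=
            lintegral_mono' Measure.restrict_le_self le_rfl
        _ = _ := by
            rw [lintegral_const_mul _ (by fun_prop), lintegral_const_mul _ (by fun_prop),
              lintegral_const_mul _ (by fun_prop), lintegral_add_left (by fun_prop),
              lintegral_sub_left_eq_self (auxm e α) t, lintegral_add_left_eq_self (auxm e α) 1]
    rw [eLpNorm_eq_lintegral_rpow_enorm_toReal (by simpa using hp0) ENNReal.ofReal_ne_top,
      ENNReal.toReal_ofReal hp0.le]
    refine le_trans ?_ hfin
    rw [one_div, ENNReal.rpow_inv_le_iff hp0]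
    refine le_trans ?_ hmink
    apply lintegral_mono
    intro x
    exact ENNReal.rpow_le_rpow (hub x) hp0.le
  have hAI : A * (ENNReal.ofReal C₀ * (I + I)) ≠ ∞ :=
    ENNReal.mul_ne_top hAtop (ENNReal.mul_ne_top ENNReal.ofReal_ne_top (by simp [hItop]))
  set D : ℝ := (A * (ENNReal.ofReal C₀ * (I + I))).toReal with hD
  have hD0 : 0 ≤ D := ENNReal.toReal_nonneg
  have h2σ : (0:ℝ) < 2 ^ |σ| := by positivity
  have hfinal : ∀ t : ℝ, 2 ≤ t →
      eLpNorm (fun x => u x t) (ENNReal.ofReal p) (volume.restrict K) ≤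
        ENNReal.ofReal (((D + 1) * 2 ^ |σ|) * t ^ (-σ)) := by
    intro t ht
    have ht0 : 0 < t := by linarith
    refine (hmain t ht).trans ?_
    calc A * (ENNReal.ofReal C₀ * (ENNReal.ofReal (2 ^ |σ| * t ^ (-σ)) * (I + I)))
        = A * (ENNReal.ofReal C₀ * (I + I)) * ENNReal.ofReal (2 ^ |σ| * t ^ (-σ)) := by ring
      _ = ENNReal.ofReal D * ENNReal.ofReal (2 ^ |σ| * t ^ (-σ)) := by
          rw [hD, ENNReal.ofReal_toReal hAI]
      _ = ENNReal.ofReal (D * (2 ^ |σ| * t ^ (-σ))) := by rw [ENNReal.ofReal_mul hD0]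
      _ ≤ _ := by
          apply ENNReal.ofReal_le_ofReal
          rw [mul_assoc]
          gcongr
          linarith
  refine ⟨(D + 1) * 2 ^ |σ|, by positivity, fun t ht => ⟨fun hg => ?_, fun hg => ?_⟩⟩
  · have := hfinal t ht
    rwa [show σ = γ from min_eq_left hg] at this ⊢
  · have := hfinal t ht
    rwa [show σ = 1 + α from min_eq_right hg] at this ⊢
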